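/- Let b > 1 be an integer, let s be a complex number with Re s > 0 and s ≠ 1, and let ℓ ≥ 2 be an integer. Then the series ∑_{m=0}^∞ (−1)^m (s·c*_{m,b}(s)/(s+m)) ∑_{b^{ℓ−1} ≤ n < b^ℓ} n^{−s−m} converges absolutely, and ((b^s − b)/b^s)·ζ(s) = ((b^s − b)/b^s) ∑_{0 < n < b^{ℓ−1}} n^{−s} + ∑_{m=0}^∞ (−1)^m (s·c*_{m,b}(s)/(s+m)) ∑_{b^{ℓ−1} ≤ n < b^ℓ} n^{−s−m}, where ζ is the Riemann zeta function. -/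

import Mathlib

open Finset

/-- γ_{j,b} = ∑_{a=1}^{b-1} a^j for a natural exponent j. -/
def gammaNat (b j : ℕ) : ℕ := ∑ a ∈ Finset.Ico 1 b, a ^ j

/-- The coefficients c*_{m,b}(s): c*_{0,b}(s) = 1 and, for m ≥ 1,
c*_{m,b}(s) = (1/(b^{s+m} − b)) ∑_{j=1}^{m} [(s+m)⋯(s+m−j+1)/j!] γ_{j,b} c*_{m−j,b}(s). -/
noncomputable def cstarC (b : ℕ) (s : ℂ) : ℕ → ℂ
  | 0 => 1
  | (m + 1) =>
      (1 / ((b : ℂ) ^ (s + (m : ℂ) + 1) - (b : ℂ))) *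
        ∑ j ∈ Finset.range (m + 1),
          ((∏ i ∈ Finset.range (j + 1), (s + (m : ℂ) + 1 - (i : ℂ))) / (Nat.factorial (j + 1) : ℂ))
            * (gammaNat b (j + 1) : ℂ) * cstarC b s (m - j)
  decreasing_by exact Nat.lt_succ_of_le (Nat.sub_le m j)


lemma hasDerivAt_cpow_aux (c : ℂ) {t : ℝ} (ht : 0 < t) :
    HasDerivAt (fun y : ℝ => (y : ℂ) ^ c) (c * (t : ℂ) ^ (c - 1)) t := by
  have h : HasDerivAt (fun z : ℂ => z ^ c) (c * (t : ℂ) ^ (c - 1) * 1) (t : ℂ) :=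
    (hasDerivAt_id (t : ℂ)).cpow_const (Or.inl (by simpa using ht))
  simpa using h.comp_ofReal

lemma cpow_diff_aux (s : ℂ) (hs : 0 < s.re) {x t : ℝ} (hx : 0 < x) (ht : t ∈ Set.Icc x (x + 1)) :
    ‖(t : ℂ) ^ (-s) - (x : ℂ) ^ (-s)‖ ≤ ‖s‖ * x ^ (-s.re - 1) := by
  have key := Convex.norm_image_sub_le_of_norm_hasDerivWithin_le
    (f := fun y : ℝ => (y : ℂ) ^ (-s)) (f' := fun y : ℝ => (-s) * (y : ℂ) ^ (-s - 1))
    (s := Set.Icc x (x + 1)) (C := ‖s‖ * x ^ (-s.re - 1)) (x := x) (y := t)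
    (fun y hy => (hasDerivAt_cpow_aux (-s) (lt_of_lt_of_le hx hy.1)).hasDerivWithinAt)
    (fun y hy => by
      have hy0 : 0 < y := lt_of_lt_of_le hx hy.1
      rw [norm_mul, norm_neg, Complex.norm_cpow_eq_rpow_re_of_pos hy0]
      gcongr ‖s‖ * ?_
      simp only [Complex.sub_re, Complex.neg_re, Complex.one_re]
      exact Real.rpow_le_rpow_of_nonpos hx hy.1 (by linarith))
    (convex_Icc _ _) (by simp) ht
  refine key.trans ?_
  have h1 : ‖t - x‖ ≤ 1 := by
    rw [Real.norm_eq_abs, abs_le]; constructor <;> linarith [ht.1, ht.2]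
  have h0 : 0 ≤ ‖s‖ * x ^ (-s.re - 1) := by positivity
  nlinarith

lemma g_bound (s : ℂ) (hs : 0 < s.re) {x : ℝ} (hx : 0 < x) :
    ‖(1 - s) * (x : ℂ) ^ (-s) - ((x + 1 : ℝ) : ℂ) ^ (1 - s) + (x : ℂ) ^ (1 - s)‖
      ≤ ‖1 - s‖ * ‖s‖ * x ^ (-s.re - 1) := by
  have key := Convex.norm_image_sub_le_of_norm_hasDerivWithin_le
    (f := fun y : ℝ => (y : ℂ) ^ (1 - s) - (y : ℂ) * ((1 - s) * (x : ℂ) ^ (-s)))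
    (f' := fun y : ℝ => (1 - s) * (y : ℂ) ^ (1 - s - 1) - 1 * ((1 - s) * (x : ℂ) ^ (-s)))
    (s := Set.Icc x (x + 1)) (C := ‖1 - s‖ * ‖s‖ * x ^ (-s.re - 1)) (x := x) (y := x + 1)
    (fun y hy => ((hasDerivAt_cpow_aux (1 - s) (lt_of_lt_of_le hx hy.1)).sub
      ((hasDerivAt_id (y : ℂ)).comp_ofReal.mul_const _)).hasDerivWithinAt)
    (fun y hy => by
      have := cpow_diff_aux s hs hx hy
      have e : (1 - s) * (y : ℂ) ^ (1 - s - 1) - 1 * ((1 - s) * (x : ℂ) ^ (-s))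
        = (1 - s) * ((y : ℂ) ^ (-s) - (x : ℂ) ^ (-s)) := by
        rw [show 1 - s - 1 = -s by ring]; ring
      rw [e, norm_mul, mul_assoc]
      gcongr)
    (convex_Icc _ _) (by simp) (by simp)
  simp only [add_sub_cancel_left, norm_one, mul_one] at key
  rw [← norm_neg]
  refine le_of_eq_of_le (congrArg _ ?_) key
  push_cast
  ring

noncomputable def gT (n : ℕ) (s : ℂ) : ℂ :=
  (1 - s) * ((n : ℂ) + 1) ^ (-s) - ((n : ℂ) + 1 + 1) ^ (1 - s) + ((n : ℂ) + 1) ^ (1 - s)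

lemma gT_bound (n : ℕ) (s : ℂ) (hs : 0 < s.re) :
    ‖gT n s‖ ≤ ‖1 - s‖ * ‖s‖ * ((n : ℝ) + 1) ^ (-s.re - 1) := by
  have := g_bound s hs (x := (n : ℝ) + 1) (by positivity)
  unfold gT
  push_cast at this
  exact this

lemma gT_sum (N : ℕ) (s : ℂ) :
    ∑ n ∈ range N, gT n s = (1 - s) * ∑ n ∈ Ico 1 (N + 1), (n : ℂ) ^ (-s)
      - ((N : ℂ) + 1) ^ (1 - s) + 1 := by
  induction N with
  | zero => simp
  | succ N ih =>
    rw [sum_range_succ, ih, sum_Ico_succ_top (by omega : 1 ≤ N + 1)]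
    unfold gT
    push_cast
    ring

lemma summable_shift {p : ℝ} (hp : 0 < p) : Summable (fun n : ℕ => ((n : ℝ) + 1) ^ (-p - 1)) := by
  have h : Summable (fun n : ℕ => (n : ℝ) ^ (-p - 1)) := Real.summable_nat_rpow.2 (by linarith)
  have := (summable_nat_add_iff 1).2 h
  simpa using this

lemma gT_summable (s : ℂ) (hs : 0 < s.re) : Summable (fun n => gT n s) :=
  Summable.of_norm_bounded ((summable_shift hs).mul_left (‖1 - s‖ * ‖s‖)) (fun n => gT_bound n s hs)

lemma gT_tsum_of_one_lt (s : ℂ) (hs : 1 < s.re) :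
    ∑' n, gT n s = 1 - riemannZeta₁ s := by
  have hs1 : s ≠ 1 := by rintro rfl; simp at hs
  have h1 := (gT_summable s (by linarith)).hasSum.tendsto_sum_nat
  refine tendsto_nhds_unique h1 ?_
  simp_rw [gT_sum]
  have hz : Filter.Tendsto (fun N : ℕ => ∑ n ∈ Ico 1 (N + 1), (n : ℂ) ^ (-s)) Filter.atTop
      (nhds (riemannZeta s)) := by
    have hsum : Summable (fun n : ℕ => 1 / ((n : ℂ) + 1) ^ s) := by
      have := (summable_nat_add_iff 1).2 (Complex.summable_one_div_nat_cpow.2 hs)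
      simpa using this
    have := hsum.hasSum.tendsto_sum_nat
    rw [← zeta_eq_tsum_one_div_nat_add_one_cpow hs] at this
    refine this.congr fun N => ?_
    rw [Finset.sum_Ico_eq_sum_range]
    refine Finset.sum_congr (by simp) fun n _ => ?_
    rw [Complex.cpow_neg, one_div]; push_cast; rw [add_comm]
  have hp : Filter.Tendsto (fun N : ℕ => ((N : ℂ) + 1) ^ (1 - s)) Filter.atTop (nhds 0) := by
    rw [tendsto_zero_iff_norm_tendsto_zero]
    have h := (tendsto_rpow_neg_atTop (y := s.re - 1) (by linarith)).comp
      (Filter.tendsto_atTop_add_const_right _ (1 : ℝ) tendsto_natCast_atTop_atTop)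
    refine h.congr fun N => ?_
    have := Complex.norm_cpow_eq_rpow_re_of_pos (x := (N : ℝ) + 1) (by positivity) (1 - s)
    push_cast at this
    rw [this]
    simp
  have := ((hz.const_mul (1 - s)).sub hp).add_const 1
  convert this using 2
  rw [riemannZeta_eq_inv_sub_mul hs1]
  have : s - 1 ≠ 0 := sub_ne_zero.2 hs1
  field_simp
  ring

lemma gT_tsum (s : ℂ) (hs : 0 < s.re) : ∑' n, gT n s = 1 - riemannZeta₁ s := by
  set U : Set ℂ := {z | s.re / 2 < z.re} ∩ Metric.ball 0 (‖s‖ + 3) with hU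
  have hUo : IsOpen U := (isOpen_lt continuous_const Complex.continuous_re).inter Metric.isOpen_ball
  have hUc : IsPreconnected U :=
    ((convex_halfSpace_re_gt _).inter (convex_ball _ _)).isPreconnected
  have hd1 : DifferentiableOn ℂ (fun z => ∑' n, gT n z) U := by
    refine Complex.differentiableOn_tsum_of_summable_norm (u := fun n : ℕ =>
      ((1 + (‖s‖ + 3)) * (‖s‖ + 3)) * ((n : ℝ) + 1) ^ (-(s.re / 2) - 1))
      ((summable_shift (by linarith)).mul_left _) ?_ hUo ?_
    · intro n
      unfold gT
      have h1 : (n : ℂ) + 1 ≠ 0 := by exact_mod_cast Nat.succ_ne_zero n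
      have h2 : (n : ℂ) + 1 + 1 ≠ 0 := by exact_mod_cast Nat.succ_ne_zero (n + 1)
      apply Differentiable.differentiableOn
      intro z
      refine DifferentiableAt.add (DifferentiableAt.sub (DifferentiableAt.mul (by fun_prop) ?_) ?_) ?_
      · exact DifferentiableAt.const_cpow (by fun_prop) (Or.inl h1)
      · exact DifferentiableAt.const_cpow (by fun_prop) (Or.inl h2)
      · exact DifferentiableAt.const_cpow (by fun_prop) (Or.inl h1)
    · intro n z hz
      have hz1 : s.re / 2 < z.re := hz.1
      have hz2 : ‖z‖ < ‖s‖ + 3 := by simpa using hz.2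
      refine (gT_bound n z (by linarith)).trans ?_
      gcongr
      · refine (norm_sub_le _ _).trans ?_
        rw [norm_one]; linarith
      · linarith [Nat.cast_nonneg (α := ℝ) n]
  have hd2 : DifferentiableOn ℂ (fun z => 1 - riemannZeta₁ z) U := by
    apply Differentiable.differentiableOn; fun_prop
  have hz0 : s + 2 ∈ U := by
    refine ⟨?_, ?_⟩
    · simp; linarith
    · simp only [Metric.mem_ball, dist_zero_right]
      refine (norm_add_le _ _).trans_lt ?_
      norm_num
  have hsU : s ∈ U := ⟨by simp; linarith, by simp⟩
  refine (hd1.analyticOnNhd hUo).eqOn_of_preconnected_of_eventuallyEq (hd2.analyticOnNhd hUo)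
    hUc hz0 ?_ hsU
  filter_upwards [(isOpen_lt continuous_const Complex.continuous_re).mem_nhds
    (show s + 2 ∈ {z : ℂ | 1 < z.re} by simp; linarith)] with z hz
  exact gT_tsum_of_one_lt z hz

lemma zeta_limit (s : ℂ) (hs : 0 < s.re) (hs1 : s ≠ 1) :
    Filter.Tendsto (fun N : ℕ => (1 - s) * ∑ n ∈ Ico 1 (N + 1), (n : ℂ) ^ (-s)
      - ((N : ℂ) + 1) ^ (1 - s)) Filter.atTop (nhds ((1 - s) * riemannZeta s)) := by
  have h1 := (gT_summable s hs).hasSum.tendsto_sum_nat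
  rw [gT_tsum s hs] at h1
  have h2 := h1.sub_const 1
  simp_rw [gT_sum] at h2
  convert h2 using 2
  · ring
  · rw [riemannZeta_eq_inv_sub_mul hs1]
    have : s - 1 ≠ 0 := sub_ne_zero.2 hs1
    field_simp
    ring

noncomputable def dC (b : ℕ) (s : ℂ) (m : ℕ) : ℂ := s * cstarC b s m / (s + (m : ℂ))

noncomputable def ris (z : ℂ) (j : ℕ) : ℂ := (∏ i ∈ range j, (z + (i : ℂ))) / (Nat.factorial j : ℂ)

lemma s_add_ne (s : ℂ) (hs : 0 < s.re) (m : ℕ) : s + (m : ℂ) ≠ 0 := by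
  intro h
  have := congrArg Complex.re h
  simp at this
  have h2 : (0 : ℝ) ≤ m := Nat.cast_nonneg m
  linarith

lemma b_norm (b : ℕ) (hb : 1 < b) (z : ℂ) : ‖(b : ℂ) ^ z‖ = (b : ℝ) ^ z.re := by
  rw [← Complex.norm_natCast_cpow_of_pos (by omega)]

lemma den_lower (b : ℕ) (hb : 1 < b) (s : ℂ) (m : ℕ) :
    ((b : ℝ) ^ s.re - 1) * (b : ℝ) ^ (m + 1) ≤ ‖(b : ℂ) ^ (s + (m : ℂ) + 1) - (b : ℂ)‖ := by
  have hb0 : (0 : ℝ) < b := by exact_mod_cast (by omega : 0 < b)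
  have hb1 : (1 : ℝ) ≤ b := by exact_mod_cast hb.le
  have h := norm_sub_norm_le ((b : ℂ) ^ (s + (m : ℂ) + 1)) (b : ℂ)
  rw [b_norm b hb, Complex.norm_natCast] at h
  have e : (s + (m : ℂ) + 1).re = s.re + ((m + 1 : ℕ) : ℝ) := by simp; ring
  rw [e, Real.rpow_add hb0, Real.rpow_natCast] at h
  have : (b : ℝ) ≤ (b : ℝ) ^ (m + 1) := le_self_pow₀ hb1 (by omega)
  nlinarith

lemma bs_gt (b : ℕ) (hb : 1 < b) (s : ℂ) (hs : 0 < s.re) : 0 < (b : ℝ) ^ s.re - 1 := by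
  have := Real.one_lt_rpow (x := (b : ℝ)) (by exact_mod_cast hb) hs
  linarith

lemma den_ne (b : ℕ) (hb : 1 < b) (s : ℂ) (hs : 0 < s.re) (m : ℕ) :
    (b : ℂ) ^ (s + (m : ℂ) + 1) - (b : ℂ) ≠ 0 := by
  have h := den_lower b hb s m
  have h2 := bs_gt b hb s hs
  have hb0 : (0 : ℝ) < b := by exact_mod_cast (by omega : 0 < b)
  rw [← norm_pos_iff]
  exact lt_of_lt_of_le (by positivity) h

lemma prod_shift (z : ℂ) (j : ℕ) :
    (∏ i ∈ range (j + 1), (z + (j : ℂ) + 1 - (i : ℂ))) * z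
      = (∏ i ∈ range (j + 1), (z + (i : ℂ))) * (z + (j : ℂ) + 1) := by
  have h1 : ∏ i ∈ range (j + 1), (z + (j : ℂ) + 1 - (i : ℂ))
      = ∏ i ∈ range (j + 1), (z + ((i + 1 : ℕ) : ℂ)) := by
    rw [← Finset.prod_range_reflect]
    refine Finset.prod_congr rfl fun i hi => ?_
    have : i ≤ j := by have := Finset.mem_range.1 hi; omega
    have e : j + 1 - 1 - i = j - i := by omega
    rw [e, Nat.cast_sub this]
    push_cast
    ring
  rw [h1]
  have h2 := Finset.prod_range_succ' (fun i : ℕ => z + (i : ℂ)) (j + 1)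
  have h3 := Finset.prod_range_succ (fun i : ℕ => z + (i : ℂ)) (j + 1)
  rw [h2] at h3
  push_cast at h3 ⊢
  simp only [add_zero] at h3
  rw [h3]; ring

lemma dC_rec (b : ℕ) (hb : 1 < b) (s : ℂ) (hs : 0 < s.re) (m : ℕ) :
    ((b : ℂ) ^ (s + (m : ℂ) + 1) - (b : ℂ)) * dC b s (m + 1)
      = ∑ j ∈ range (m + 1), ris (s + ((m - j : ℕ) : ℂ)) (j + 1) * (gammaNat b (j + 1) : ℂ)
          * dC b s (m - j) := by
  have hd := den_ne b hb s hs m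
  unfold dC
  rw [cstarC]
  have hm := s_add_ne s hs (m + 1)
  have : ((b : ℂ) ^ (s + (m : ℂ) + 1) - (b : ℂ)) *
      (s * (1 / ((b : ℂ) ^ (s + (m : ℂ) + 1) - (b : ℂ)) *
        ∑ j ∈ Finset.range (m + 1),
          ((∏ i ∈ Finset.range (j + 1), (s + (m : ℂ) + 1 - (i : ℂ))) / (Nat.factorial (j + 1) : ℂ))
            * (gammaNat b (j + 1) : ℂ) * cstarC b s (m - j)) / (s + ((m + 1 : ℕ) : ℂ)))
      = (s / (s + ((m + 1 : ℕ) : ℂ))) * ∑ j ∈ Finset.range (m + 1),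
          ((∏ i ∈ Finset.range (j + 1), (s + (m : ℂ) + 1 - (i : ℂ))) / (Nat.factorial (j + 1) : ℂ))
            * (gammaNat b (j + 1) : ℂ) * cstarC b s (m - j) := by
    field_simp
  rw [this, Finset.mul_sum]
  refine Finset.sum_congr rfl fun j hj => ?_
  have hjm : j ≤ m := by have := Finset.mem_range.1 hj; omega
  obtain ⟨k, rfl⟩ := Nat.exists_eq_add_of_le hjm
  have hk : j + k - j = k := by omega
  rw [hk]
  have hz := s_add_ne s hs k
  have hp := prod_shift (s + (k : ℂ)) j
  unfold ris
  have hf : ((j + 1).factorial : ℂ) ≠ 0 := by exact_mod_cast Nat.factorial_ne_zero _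
  have e1 : ∏ i ∈ Finset.range (j + 1), (s + ((j + k : ℕ) : ℂ) + 1 - (i : ℂ))
      = ∏ i ∈ range (j + 1), (s + (k : ℂ) + (j : ℂ) + 1 - (i : ℂ)) := by
    refine Finset.prod_congr rfl fun i _ => ?_
    push_cast; ring
  have e2 : s + ((j + k + 1 : ℕ) : ℂ) = s + (k : ℂ) + (j : ℂ) + 1 := by push_cast; ring
  rw [e1]
  rw [e2] at hm ⊢
  generalize (∏ i ∈ range (j + 1), (s + (k : ℂ) + (j : ℂ) + 1 - (i : ℂ))) = A at *
  generalize (∏ i ∈ range (j + 1), (s + (k : ℂ) + (i : ℂ))) = B at *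
  have : A = B * (s + (k : ℂ) + (j : ℂ) + 1) / (s + k) := by
    rw [← hp]; field_simp
  rw [this]
  field_simp

lemma dC_zero (b : ℕ) (s : ℂ) (hs : 0 < s.re) : dC b s 0 = 1 := by
  have := s_add_ne s hs 0
  unfold dC; rw [cstarC]
  rw [mul_one]
  rw [Nat.cast_zero, add_zero] at this ⊢
  exact div_self this

lemma ris_zero (z : ℂ) : ris z 0 = 1 := by simp [ris]

lemma gamma_range (b : ℕ) (j : ℕ) :
    (gammaNat b (j + 1) : ℂ) = ∑ a ∈ range b, (a : ℂ) ^ (j + 1) := by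
  unfold gammaNat
  push_cast
  rcases b with _ | b
  · simp
  · rw [Finset.sum_Ico_eq_sum_range, Finset.sum_range_succ']
    simp [add_comm]

lemma dC_anti (b : ℕ) (hb : 1 < b) (s : ℂ) (hs : 0 < s.re) (m : ℕ) :
    ∑ p ∈ antidiagonal m, dC b s p.1 * ris (s + (p.1 : ℂ)) p.2 * ∑ a ∈ range b, (a : ℂ) ^ p.2
      = if m = 0 then (b : ℂ) else (b : ℂ) ^ (s + (m : ℂ)) * dC b s m := by
  rcases m with _ | m
  · simp [dC_zero b s hs, ris_zero]
  · have hr := dC_rec b hb s hs m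
    rw [← Finset.Nat.sum_antidiagonal_swap,
      Finset.Nat.sum_antidiagonal_eq_sum_range_succ_mk, Finset.sum_range_succ']
    have : ∀ j ∈ range (m + 1), dC b s (m + 1 - (j + 1)) * ris (s + ((m + 1 - (j + 1) : ℕ) : ℂ)) (j + 1)
        * ∑ a ∈ range b, (a : ℂ) ^ (j + 1) = ris (s + ((m - j : ℕ) : ℂ)) (j + 1)
          * (gammaNat b (j + 1) : ℂ) * dC b s (m - j) := by
      intro j _
      rw [← gamma_range, Nat.add_sub_add_right]; ring
    simp only [Prod.swap_prod_mk]
    rw [Finset.sum_congr rfl this, ← hr]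
    simp [ris_zero]
    rw [← add_assoc]; ring

lemma ris_bound (s : ℂ) (T : ℕ) (hT : ‖s‖ ≤ T + 1) (k j : ℕ) :
    ‖ris (s + (k : ℂ)) j‖ ≤ ((T + k + j).choose j : ℝ) := by
  unfold ris
  rw [norm_div, Complex.norm_natCast, norm_prod, div_le_iff₀ (by positivity)]
  have h := Nat.ascFactorial_eq_factorial_mul_choose (T + k) j
  have h2 := Nat.ascFactorial_eq_prod_range (T + k + 1) j
  have h3 : (((T + k + j).choose j : ℕ) : ℝ) * (j.factorial : ℝ)
      = ∏ i ∈ range j, ((T : ℝ) + k + 1 + i) := by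
    rw [mul_comm]
    have : ((j.factorial * (T + k + j).choose j : ℕ) : ℝ) = ((∏ i ∈ range j, (T + k + 1 + i) : ℕ) : ℝ) := by
      rw [← h, h2]
    push_cast at this
    exact this
  rw [h3]
  refine Finset.prod_le_prod (fun _ _ => norm_nonneg _) fun i _ => ?_
  refine (norm_add_le _ _).trans ?_
  refine (add_le_add_left (norm_add_le _ _) _).trans ?_
  rw [Complex.norm_natCast, Complex.norm_natCast]
  linarith

lemma gamma_real_sum (b m T : ℕ) (hb : 1 < b) :
    ∑ j ∈ range (m + 1), ((T + m + 1).choose (j + 1) : ℝ) * (gammaNat b (j + 1) : ℝ)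
        * (3 / 2 : ℝ) ^ (m - j)
      ≤ (3 / 2 : ℝ) ^ (m + 1) * (b * (1 + ((b : ℝ) - 1) / (3 / 2)) ^ (T + m + 1)) := by
  have hb1 : (1 : ℝ) ≤ b := by exact_mod_cast hb.le
  have h1 : ∀ j ∈ range (m + 1), ((T + m + 1).choose (j + 1) : ℝ) * (gammaNat b (j + 1) : ℝ)
        * (3 / 2 : ℝ) ^ (m - j) = (3 / 2 : ℝ) ^ (m + 1) * ∑ a ∈ Ico 1 b,
          ((a : ℝ) / (3 / 2)) ^ (j + 1) * ((T + m + 1).choose (j + 1) : ℝ) := by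
    intro j hj
    have hjm : j ≤ m := by have := Finset.mem_range.1 hj; omega
    have e : (3 / 2 : ℝ) ^ (m + 1) = (3 / 2 : ℝ) ^ (m - j) * (3 / 2 : ℝ) ^ (j + 1) := by
      rw [← pow_add]; congr 1; omega
    unfold gammaNat
    push_cast
    rw [← Finset.sum_mul]
    simp_rw [div_pow (_ : ℝ) (3 / 2 : ℝ)]
    rw [← Finset.sum_div, e]
    have : (3 / 2 : ℝ) ^ (j + 1) ≠ 0 := by positivity
    field_simp
  rw [Finset.sum_congr rfl h1, ← Finset.mul_sum]
  gcongr ?_ * ?_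
  rw [Finset.sum_comm]
  have h2 : ∀ a ∈ Ico 1 b, ∑ j ∈ range (m + 1),
      ((a : ℝ) / (3 / 2)) ^ (j + 1) * ((T + m + 1).choose (j + 1) : ℝ)
        ≤ (1 + ((b : ℝ) - 1) / (3 / 2)) ^ (T + m + 1) := by
    intro a ha
    have hab : (a : ℝ) ≤ (b : ℝ) - 1 := by
      have := (Finset.mem_Ico.1 ha).2
      have : ((a + 1 : ℕ) : ℝ) ≤ b := by exact_mod_cast this
      push_cast at this; linarith
    have h3 : (1 + (a : ℝ) / (3 / 2)) ^ (T + m + 1) ≤ (1 + ((b : ℝ) - 1) / (3 / 2)) ^ (T + m + 1) := by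
      gcongr
    refine le_trans ?_ h3
    rw [add_comm (1 : ℝ), add_pow]
    simp only [one_pow, mul_one]
    rw [Finset.sum_range_succ' _ (T + m + 1)]
    have h4 : ∑ j ∈ range (m + 1), ((a : ℝ) / (3 / 2)) ^ (j + 1) * ((T + m + 1).choose (j + 1) : ℝ)
      ≤ ∑ j ∈ range (T + m + 1), ((a : ℝ) / (3 / 2)) ^ (j + 1) * ((T + m + 1).choose (j + 1) : ℝ) := by
      refine Finset.sum_le_sum_of_subset_of_nonneg ?_ (fun i _ _ => by positivity)
      intro i hi
      simp only [Finset.mem_range] at *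
      omega
    refine h4.trans ?_
    simp
  refine (Finset.sum_le_card_nsmul _ _ _ h2).trans ?_
  rw [Nat.card_Ico, nsmul_eq_mul]
  have hq : 0 ≤ ((b : ℝ) - 1) / (3 / 2) := by apply div_nonneg <;> linarith
  gcongr
  omega

lemma dC_growth (b : ℕ) (hb : 1 < b) (s : ℂ) (hs : 0 < s.re) :
    ∃ C : ℝ, 0 ≤ C ∧ ∀ m, ‖dC b s m‖ ≤ C * (3 / 2 : ℝ) ^ m := by
  obtain ⟨T, hT⟩ := exists_nat_ge ‖s‖
  have hT' : ‖s‖ ≤ (T : ℝ) + 1 := by linarith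
  have hb1 : (1 : ℝ) < b := by exact_mod_cast hb
  have hb0 : (0 : ℝ) < b := by linarith
  set Q : ℝ := 1 + ((b : ℝ) - 1) / (3 / 2) with hQ
  have hQ0 : 0 < Q := by
    have : 0 < ((b : ℝ) - 1) / (3 / 2) := div_pos (by linarith) (by norm_num)
    positivity
  have hQb : Q / b < 1 := by
    rw [div_lt_one hb0, hQ]; linarith
  have hlow := bs_gt b hb s hs
  have hlim : Filter.Tendsto (fun m : ℕ => (b * Q ^ T) * (Q / b) ^ m) Filter.atTop (nhds 0) := by
    have := (tendsto_pow_atTop_nhds_zero_of_lt_one (by positivity) hQb).const_mul (b * Q ^ T)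
    simpa using this
  obtain ⟨M, hM⟩ := Filter.eventually_atTop.1 (hlim.eventually (gt_mem_nhds hlow))
  refine ⟨∑ m ∈ range (M + 1), ‖dC b s m‖, Finset.sum_nonneg fun _ _ => norm_nonneg _, ?_⟩
  set C := ∑ m ∈ range (M + 1), ‖dC b s m‖ with hC
  have hC0 : 0 ≤ C := Finset.sum_nonneg fun _ _ => norm_nonneg _
  intro m
  induction m using Nat.strong_induction_on with
  | _ m ih =>
  by_cases hm : m ≤ M
  · have h1 : ‖dC b s m‖ ≤ C :=
      Finset.single_le_sum (f := fun m => ‖dC b s m‖) (fun _ _ => norm_nonneg _)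
        (Finset.mem_range.2 (by omega))
    have h2 : (1 : ℝ) ≤ (3 / 2 : ℝ) ^ m := one_le_pow₀ (by norm_num)
    nlinarith
  · obtain ⟨k, rfl⟩ : ∃ k, m = k + 1 := ⟨m - 1, by omega⟩
    have hr := congrArg norm (dC_rec b hb s hs k)
    rw [norm_mul] at hr
    have h1 : ‖∑ j ∈ range (k + 1), ris (s + ((k - j : ℕ) : ℂ)) (j + 1) * (gammaNat b (j + 1) : ℂ)
          * dC b s (k - j)‖ ≤ C * ∑ j ∈ range (k + 1), ((T + k + 1).choose (j + 1) : ℝ)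
            * (gammaNat b (j + 1) : ℝ) * (3 / 2 : ℝ) ^ (k - j) := by
      rw [Finset.mul_sum]
      refine norm_sum_le_of_le _ fun j hj => ?_
      have hjm : j ≤ k := by have := Finset.mem_range.1 hj; omega
      rw [norm_mul, norm_mul, Complex.norm_natCast]
      have h2 := ris_bound s T hT' (k - j) (j + 1)
      rw [show T + (k - j) + (j + 1) = T + k + 1 by omega] at h2
      have h3 := ih (k - j) (by omega)
      calc _ ≤ ((T + k + 1).choose (j + 1) : ℝ) * (gammaNat b (j + 1) : ℝ)
            * (C * (3 / 2 : ℝ) ^ (k - j)) := by gcongr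
        _ = _ := by ring
    have h2 := gamma_real_sum b k T hb
    have h3 := den_lower b hb s k
    have h4 := hM (k + 1) (by omega)
    have hpos : 0 < ((b : ℝ) ^ s.re - 1) * (b : ℝ) ^ (k + 1) := by positivity
    have h5 : b * Q ^ (T + k + 1) ≤ ((b : ℝ) ^ s.re - 1) * (b : ℝ) ^ (k + 1) := by
      have := mul_le_mul_of_nonneg_right h4.le (by positivity : (0 : ℝ) ≤ (b : ℝ) ^ (k + 1))
      refine le_trans (le_of_eq ?_) this
      rw [div_pow, add_assoc T, pow_add Q T]
      field_simp
    have h6 : ((b : ℝ) ^ s.re - 1) * (b : ℝ) ^ (k + 1) * ‖dC b s (k + 1)‖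
        ≤ ((b : ℝ) ^ s.re - 1) * (b : ℝ) ^ (k + 1) * (C * (3 / 2 : ℝ) ^ (k + 1)) := by
      calc _ ≤ ‖(b : ℂ) ^ (s + (k : ℂ) + 1) - (b : ℂ)‖ * ‖dC b s (k + 1)‖ := by gcongr
        _ ≤ C * _ := by rw [hr]; exact h1
        _ ≤ C * ((3 / 2 : ℝ) ^ (k + 1) * (b * Q ^ (T + k + 1))) := by gcongr
        _ ≤ C * ((3 / 2 : ℝ) ^ (k + 1) * (((b : ℝ) ^ s.re - 1) * (b : ℝ) ^ (k + 1))) := by gcongr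
        _ = _ := by ring
    exact le_of_mul_le_mul_left h6 hpos

lemma ris_eq_choose (z : ℂ) (j : ℕ) : Ring.choose (z + j - 1) j = ris z j := by
  have hf : (j.factorial : ℂ) ≠ 0 := by exact_mod_cast Nat.factorial_ne_zero _
  have h := Ring.factorial_nsmul_multichoose_eq_ascPochhammer z j
  rw [Ring.multichoose_eq, Polynomial.ascPochhammer_smeval_eq_eval, nsmul_eq_mul] at h
  unfold ris
  rw [eq_div_iff hf, mul_comm, h]
  clear h hf
  induction j with
  | zero => simp
  | succ j ih => rw [ascPochhammer_succ_eval, ih, Finset.prod_range_succ]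

lemma binom_exp (z : ℂ) {N a : ℕ} (h : a < N) :
    HasSum (fun j : ℕ => (-1 : ℂ) ^ j * ris z j * (a : ℂ) ^ j * (N : ℂ) ^ (-(z + (j : ℂ))))
      (((N + a : ℕ) : ℂ) ^ (-z)) := by
  have hN : (0 : ℝ) < N := by exact_mod_cast (by omega : 0 < N)
  have hNc : (N : ℂ) ≠ 0 := by exact_mod_cast hN.ne'
  have haN : (a : ℝ) / N < 1 := by rw [div_lt_one hN]; exact_mod_cast h
  have key := (Complex.one_div_one_sub_cpow_hasFPowerSeriesOnBall_zero z).hasSum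
    (y := -((a : ℂ) / N)) (by
      simp only [Metric.mem_eball, edist_zero_right, enorm_neg]
      rw [← ofReal_norm, norm_div, Complex.norm_natCast, Complex.norm_natCast]
      simpa using haN)
  simp only [FormalMultilinearSeries.ofScalars_apply_eq, ris_eq_choose, zero_add] at key
  have key2 := key.mul_left ((N : ℂ) ^ (-z))
  have e0 : (fun j : ℕ => (-1 : ℂ) ^ j * ris z j * (a : ℂ) ^ j * (N : ℂ) ^ (-(z + (j : ℂ))))
      = fun i : ℕ => (N : ℂ) ^ (-z) * ris z i • (-((a : ℂ) / N)) ^ i := by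
    funext j
    rw [neg_add, Complex.cpow_add _ _ hNc, Complex.cpow_neg _ (j : ℂ), Complex.cpow_natCast,
      smul_eq_mul, neg_pow ((a : ℂ) / N), div_pow]
    field_simp
  have e1 : ((N + a : ℕ) : ℂ) ^ (-z) = (N : ℂ) ^ (-z) * (1 / (1 - -((a : ℂ) / N)) ^ z) := by
    have e : ((N + a : ℕ) : ℂ) = ((N : ℝ) : ℂ) * ((1 + (a : ℝ) / N : ℝ) : ℂ) := by
      push_cast; field_simp
    rw [e, Complex.mul_cpow_ofReal_nonneg hN.le (by positivity), Complex.cpow_neg _ z,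
      Complex.cpow_neg _ z]
    push_cast
    rw [sub_neg_eq_add, one_div, Complex.cpow_neg _ z]
  rw [e0, e1]
  exact key2

/-- The term of the series. -/
noncomputable def hT (b : ℕ) (s : ℂ) (n m : ℕ) : ℂ :=
  (-1 : ℂ) ^ m * dC b s m * (n : ℂ) ^ (-(s + (m : ℂ)))

noncomputable def HH (b : ℕ) (s : ℂ) (n : ℕ) : ℂ := ∑' m, hT b s n m

lemma n_norm (n : ℕ) (hn : 0 < n) (s : ℂ) (m : ℕ) :
    ‖(n : ℂ) ^ (-(s + (m : ℂ)))‖ = (n : ℝ) ^ (-s.re) * ((n : ℝ) ^ m)⁻¹ := by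
  rw [Complex.norm_natCast_cpow_of_pos hn]
  have hn0 : (0 : ℝ) < n := by exact_mod_cast hn
  simp only [Complex.neg_re, Complex.add_re, Complex.natCast_re]
  rw [neg_add, Real.rpow_add hn0, Real.rpow_neg hn0.le (m : ℝ), Real.rpow_natCast]

lemma hT_bound (b : ℕ) (s : ℂ) (C : ℝ) (hC : ∀ m, ‖dC b s m‖ ≤ C * (3 / 2 : ℝ) ^ m)
    (n : ℕ) (hn : 0 < n) (m : ℕ) :
    ‖hT b s n m‖ ≤ C * (n : ℝ) ^ (-s.re) * ((3 / 2 : ℝ) / n) ^ m := by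
  unfold hT
  rw [norm_mul, norm_mul, norm_pow, norm_neg, norm_one, one_pow, one_mul, n_norm n hn]
  calc _ ≤ (C * (3 / 2 : ℝ) ^ m) * ((n : ℝ) ^ (-s.re) * ((n : ℝ) ^ m)⁻¹) := by
        gcongr
        exact hC m
    _ = _ := by rw [div_pow _ (n : ℝ)]; ring

lemma ratio_lt (n : ℕ) (hn : 2 ≤ n) : (3 / 2 : ℝ) / n ≤ 3 / 4 := by
  have : (2 : ℝ) ≤ n := by exact_mod_cast hn
  rw [div_le_iff₀ (by linarith)]; linarith

lemma hT_summable (b : ℕ) (hb : 1 < b) (s : ℂ) (hs : 0 < s.re) (n : ℕ) (hn : 2 ≤ n) :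
    Summable (fun m => ‖hT b s n m‖) := by
  obtain ⟨C, hC0, hC⟩ := dC_growth b hb s hs
  refine Summable.of_nonneg_of_le (fun _ => norm_nonneg _)
    (fun m => hT_bound b s C hC n (by omega) m) ?_
  refine (summable_geometric_of_lt_one (by positivity) ?_).mul_left _
  linarith [ratio_lt n hn]

lemma HH_decay (b : ℕ) (hb : 1 < b) (s : ℂ) (hs : 0 < s.re) :
    ∃ C : ℝ, 0 ≤ C ∧ ∀ n : ℕ, 2 ≤ n →
      ‖HH b s n - (n : ℂ) ^ (-s)‖ ≤ C * (n : ℝ) ^ (-s.re - 1) := by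
  obtain ⟨C, hC0, hC⟩ := dC_growth b hb s hs
  refine ⟨C * (3 / 2) * (1 - 3 / 4)⁻¹, by positivity, fun n hn => ?_⟩
  have hsum := (hT_summable b hb s hs n hn).of_norm
  have h0 : hT b s n 0 = (n : ℂ) ^ (-s) := by simp [hT, dC_zero b s hs]
  unfold HH
  rw [hsum.tsum_eq_zero_add, h0, add_sub_cancel_left]
  have hn0 : (0 : ℝ) < n := by exact_mod_cast (by omega : 0 < n)
  have hg := (hasSum_geometric_of_lt_one (r := (3 / 4 : ℝ)) (by norm_num) (by norm_num)).mul_left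
    (C * (3 / 2) * (n : ℝ) ^ (-s.re - 1))
  refine (tsum_of_norm_bounded hg fun m => ?_).trans (le_of_eq (by ring))
  refine (hT_bound b s C hC n (by omega) (m + 1)).trans ?_
  have e : C * (n : ℝ) ^ (-s.re) * ((3 / 2 : ℝ) / n) ^ (m + 1)
      = C * (3 / 2) * (n : ℝ) ^ (-s.re - 1) * ((3 / 2 : ℝ) / n) ^ m := by
    rw [Real.rpow_sub_one hn0.ne', pow_succ]; ring
  rw [e]
  have hr := ratio_lt n hn
  gcongr ?_ * ?_ ^ m

noncomputable def ff (b : ℕ) (s : ℂ) (N a : ℕ) (p : ℕ × ℕ) : ℂ :=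
  (-1 : ℂ) ^ p.1 * dC b s p.1 * ((-1 : ℂ) ^ p.2 * ris (s + (p.1 : ℂ)) p.2 * (a : ℂ) ^ p.2
    * (N : ℂ) ^ (-(s + (p.1 : ℂ) + (p.2 : ℂ))))

lemma ff_summable (b : ℕ) (hb : 1 < b) (s : ℂ) (hs : 0 < s.re) (N a : ℕ) (h : a + 2 ≤ N) :
    Summable (ff b s N a) := by
  obtain ⟨C, hC0, hC⟩ := dC_growth b hb s hs
  obtain ⟨T, hT⟩ := exists_nat_ge ‖s‖
  have hT' : ‖s‖ ≤ (T : ℝ) + 1 := by linarith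
  have hN : (0 : ℝ) < N := by exact_mod_cast (by omega : 0 < N)
  have haN : (a : ℝ) + 2 ≤ N := by exact_mod_cast h
  set x : ℝ := (a : ℝ) / N with hx
  have hx0 : 0 ≤ x := by positivity
  have hx1 : x < 1 := by rw [hx, div_lt_one hN]; linarith
  have hgeo : ∀ k : ℕ, HasSum (fun j : ℕ => ((j + (T + k)).choose (T + k) : ℝ) * x ^ j)
      (1 / (1 - x) ^ (T + k + 1)) := fun k =>
    hasSum_choose_mul_geometric_of_norm_lt_one (T + k)
      (by rw [Real.norm_eq_abs, abs_of_nonneg hx0]; exact hx1)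
  let B : ℕ × ℕ → ℝ := fun p => C * (N : ℝ) ^ (-s.re) * ((3 / 2 : ℝ) / N) ^ p.1
    * (((p.2 + (T + p.1)).choose (T + p.1) : ℝ) * x ^ p.2)
  have hB0 : 0 ≤ B := fun p => by
    simp only [B, Pi.zero_apply]; positivity
  have hB : Summable B := by
    rw [summable_prod_of_nonneg hB0]
    have hk : ∀ k : ℕ, HasSum (fun j : ℕ => B (k, j)) (C * (N : ℝ) ^ (-s.re) * ((3 / 2 : ℝ) / N) ^ k
        * (1 / (1 - x) ^ (T + k + 1))) := fun k =>
      (hgeo k).mul_left (C * (N : ℝ) ^ (-s.re) * ((3 / 2 : ℝ) / N) ^ k)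
    refine ⟨fun k => (hk k).summable, ?_⟩
    have e : (fun k => ∑' j, B (k, j)) = fun k : ℕ => (C * (N : ℝ) ^ (-s.re) * (1 / (1 - x) ^ (T + 1)))
        * (((3 / 2 : ℝ) / N) * (1 / (1 - x))) ^ k := by
      funext k
      rw [(hk k).tsum_eq, mul_pow, one_div_pow,
        show T + k + 1 = (T + 1) + k by ring, pow_add (1 - x)]
      have : 1 - x ≠ 0 := by linarith
      field_simp
    rw [e]
    refine (summable_geometric_of_lt_one ?_ ?_).mul_left _
    · have : 0 < 1 - x := by linarith
      positivity
    · have e2 : ((3 / 2 : ℝ) / N) * (1 / (1 - x)) = (3 / 2) / (N - a) := by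
        have h1 : (N : ℝ) - a ≠ 0 := by linarith
        have h2 : 1 - x = (N - a) / N := by rw [hx]; field_simp
        rw [h2]; field_simp
      rw [e2, div_lt_one (by linarith)]
      linarith
  refine Summable.of_norm_bounded hB fun p => ?_
  obtain ⟨k, j⟩ := p
  simp only [ff, B]
  have e3 : s + (k : ℂ) + (j : ℂ) = s + ((k + j : ℕ) : ℂ) := by push_cast; ring
  rw [e3]
  simp only [norm_mul, norm_pow, norm_neg, norm_one, one_pow, one_mul, Complex.norm_natCast]
  rw [n_norm N (by omega)]
  have h1 := ris_bound s T hT' k j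
  have h2 : (T + k + j).choose j = (j + (T + k)).choose (T + k) := by
    rw [add_comm j, ← Nat.choose_symm_add]
  rw [h2] at h1
  calc _ ≤ (C * (3 / 2 : ℝ) ^ k) * (((j + (T + k)).choose (T + k) : ℝ) * (a : ℝ) ^ j
        * ((N : ℝ) ^ (-s.re) * ((N : ℝ) ^ (k + j))⁻¹)) := by
        gcongr
        exact hC k
    _ = _ := by
      rw [hx, div_pow (a : ℝ) (N : ℝ), div_pow (3 / 2 : ℝ) (N : ℝ), pow_add]; ring

lemma ff_hasSum (b : ℕ) (hb : 1 < b) (s : ℂ) (hs : 0 < s.re) (N a : ℕ) (h : a + 2 ≤ N) :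
    HasSum (fun m => ∑ p ∈ antidiagonal m, ff b s N a p) (HH b s (N + a)) := by
  have hsum := ff_summable b hb s hs N a h
  have h1 : ∑' p, ff b s N a p = HH b s (N + a) := by
    rw [hsum.tsum_prod]
    unfold HH
    refine tsum_congr fun k => ?_
    unfold hT
    have hk : HasSum (fun j => ff b s N a (k, j)) ((-1 : ℂ) ^ k * dC b s k
        * ((N + a : ℕ) : ℂ) ^ (-(s + (k : ℂ)))) :=
      (binom_exp (s + (k : ℂ)) (by omega : a < N)).mul_left ((-1 : ℂ) ^ k * dC b s k)
    exact hk.tsum_eq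
  have h2 := hsum.hasSum
  rw [h1, ← Finset.HasAntidiagonal.sigmaAntidiagonalEquivProd.hasSum_iff] at h2
  have h3 := h2.sigma (fun m => hasSum_fintype _)
  have e : (fun m => ∑ p ∈ antidiagonal m, ff b s N a p) = fun m => ∑ c : antidiagonal m,
      (ff b s N a ∘ ⇑Finset.HasAntidiagonal.sigmaAntidiagonalEquivProd) ⟨m, c⟩ := by
    funext m
    exact (Finset.sum_finset_coe (ff b s N a) (antidiagonal m)).symm
  rw [e]
  exact h3

lemma HH_step (b : ℕ) (hb : 1 < b) (s : ℂ) (hs : 0 < s.re) (n : ℕ) (hn : b ≤ n) :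
    ∑ a ∈ range b, HH b s (b * n + a)
      = HH b s n - ((b : ℂ) ^ s - (b : ℂ)) / (b : ℂ) ^ s * (n : ℂ) ^ (-s) := by
  have hb0 : (b : ℂ) ≠ 0 := by exact_mod_cast (by omega : b ≠ 0)
  have hbs : (b : ℂ) ^ s ≠ 0 := by simp [Complex.cpow_eq_zero_iff, hb0]
  have h1 : HasSum (fun m => ∑ a ∈ range b, ∑ p ∈ antidiagonal m, ff b s (b * n) a p)
      (∑ a ∈ range b, HH b s (b * n + a)) := by
    refine hasSum_sum fun a ha => ff_hasSum b hb s hs (b * n) a ?_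
    have : a < b := Finset.mem_range.1 ha
    nlinarith
  have h2 : HasSum (fun m => hT b s n m + if m = 0 then
      -(((b : ℂ) ^ s - (b : ℂ)) / (b : ℂ) ^ s * (n : ℂ) ^ (-s)) else 0)
      (HH b s n + -(((b : ℂ) ^ s - (b : ℂ)) / (b : ℂ) ^ s * (n : ℂ) ^ (-s))) :=
    (hT_summable b hb s hs n (by omega)).of_norm.hasSum.add (hasSum_ite_eq 0 _)
  rw [sub_eq_add_neg]
  refine h1.unique ?_
  convert h2 using 2 with m
  have e1 : ∑ a ∈ range b, ∑ p ∈ antidiagonal m, ff b s (b * n) a p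
      = (-1 : ℂ) ^ m * ((b * n : ℕ) : ℂ) ^ (-(s + (m : ℂ))) * ∑ p ∈ antidiagonal m,
        dC b s p.1 * ris (s + (p.1 : ℂ)) p.2 * ∑ a ∈ range b, (a : ℂ) ^ p.2 := by
    rw [Finset.sum_comm, Finset.mul_sum]
    refine Finset.sum_congr rfl fun p hp => ?_
    rw [Finset.mul_sum, Finset.mul_sum]
    refine Finset.sum_congr rfl fun a _ => ?_
    have hpm : p.1 + p.2 = m := Finset.HasAntidiagonal.mem_antidiagonal.1 hp
    unfold ff
    rw [← hpm, pow_add]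
    push_cast
    rw [← add_assoc]
    ring
  have e2 : ((b * n : ℕ) : ℂ) ^ (-(s + (m : ℂ)))
      = ((b : ℂ) ^ (s + (m : ℂ)))⁻¹ * (n : ℂ) ^ (-(s + (m : ℂ))) := by
    have := Complex.mul_cpow_ofReal_nonneg (a := (b : ℝ)) (b := (n : ℝ)) (by positivity)
      (by positivity) (-(s + (m : ℂ)))
    push_cast at this ⊢
    rw [this, Complex.cpow_neg]
  rw [e1, dC_anti b hb s hs m, e2]
  have hbm : (b : ℂ) ^ (s + (m : ℂ)) ≠ 0 := by simp [Complex.cpow_eq_zero_iff, hb0]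
  unfold hT
  split_ifs with hm
  · subst hm
    simp only [dC_zero b s hs, Nat.cast_zero, add_zero, pow_zero] at *
    field_simp
    ring
  · field_simp
    ring

lemma sum_Ico_mul (b x y : ℕ) (hxy : x ≤ y) (f : ℕ → ℂ) :
    ∑ k ∈ Ico (b * x) (b * y), f k = ∑ n ∈ Ico x y, ∑ a ∈ range b, f (b * n + a) := by
  induction y, hxy using Nat.le_induction with
  | base => simp
  | succ y hxy ih =>
    rw [Finset.sum_Ico_succ_top hxy, ← ih, ← Finset.sum_Ico_consecutive _
      (Nat.mul_le_mul_left b hxy) (Nat.mul_le_mul_left b (Nat.le_succ y)),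
      Finset.sum_Ico_eq_sum_range (m := b * y)]
    congr 2
    rw [Nat.succ_eq_add_one, mul_add]; simp

noncomputable def PP (s : ℂ) (N : ℕ) : ℂ := ∑ n ∈ Ico 1 N, (n : ℂ) ^ (-s)

noncomputable def SS (b : ℕ) (s : ℂ) (L : ℕ) : ℂ := ∑ n ∈ Ico (b ^ L) (b ^ (L + 1)), HH b s n

noncomputable def AA (b : ℕ) (s : ℂ) (L : ℕ) : ℂ :=
  ((b : ℂ) ^ s - (b : ℂ)) / (b : ℂ) ^ s * PP s (b ^ L) + SS b s L

lemma PP_diff (b : ℕ) (hb : 1 < b) (s : ℂ) (L : ℕ) :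
    ∑ n ∈ Ico (b ^ L) (b ^ (L + 1)), (n : ℂ) ^ (-s) = PP s (b ^ (L + 1)) - PP s (b ^ L) := by
  unfold PP
  rw [← Finset.sum_Ico_consecutive _ (Nat.one_le_pow L b (by omega))
    (Nat.pow_le_pow_right (by omega) (Nat.le_succ L))]
  ring

lemma AA_step (b : ℕ) (hb : 1 < b) (s : ℂ) (hs : 0 < s.re) (L : ℕ) (hL : 1 ≤ L) :
    AA b s (L + 1) = AA b s L := by
  have h1 : SS b s (L + 1) = SS b s L - ((b : ℂ) ^ s - (b : ℂ)) / (b : ℂ) ^ s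
      * ∑ n ∈ Ico (b ^ L) (b ^ (L + 1)), (n : ℂ) ^ (-s) := by
    unfold SS
    rw [pow_succ' b (L + 1), pow_succ' b L,
      sum_Ico_mul b (b ^ L) (b * b ^ L) (Nat.le_mul_of_pos_left _ (by omega)), Finset.mul_sum,
      ← Finset.sum_sub_distrib]
    refine Finset.sum_congr rfl fun n hn => HH_step b hb s hs n ?_
    exact (Nat.le_self_pow (by omega) b).trans (Finset.mem_Ico.1 hn).1
  unfold AA
  rw [h1, PP_diff b hb]
  ring

lemma AA_const (b : ℕ) (hb : 1 < b) (s : ℂ) (hs : 0 < s.re) (L : ℕ) (hL : 1 ≤ L) (k : ℕ) :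
    AA b s (L + k) = AA b s L := by
  induction k with
  | zero => rfl
  | succ k ih => rw [← add_assoc, AA_step b hb s hs _ (by omega), ih]

lemma err_limit (b : ℕ) (hb : 1 < b) (s : ℂ) (hs : 0 < s.re) :
    Filter.Tendsto (fun L => SS b s L - (PP s (b ^ (L + 1)) - PP s (b ^ L))) Filter.atTop
      (nhds 0) := by
  obtain ⟨C, hC0, hC⟩ := HH_decay b hb s hs
  have hb0 : (0 : ℝ) < b := by exact_mod_cast (by omega : 0 < b)
  have hb1 : (1 : ℝ) < b := by exact_mod_cast hb
  have hlt : (b : ℝ) ^ (-s.re) < 1 := Real.rpow_lt_one_of_one_lt_of_neg hb1 (by linarith)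
  have hlim := (tendsto_pow_atTop_nhds_zero_of_lt_one (by positivity) hlt).const_mul (C * b)
  rw [mul_zero] at hlim
  refine squeeze_zero_norm' ?_ hlim
  filter_upwards [Filter.eventually_ge_atTop 1] with L hL
  rw [← PP_diff b hb]
  unfold SS
  rw [← Finset.sum_sub_distrib]
  have hbL : (0 : ℝ) < (b : ℝ) ^ L := by positivity
  have h1 : ∀ n ∈ Ico (b ^ L) (b ^ (L + 1)), ‖HH b s n - (n : ℂ) ^ (-s)‖
      ≤ C * ((b : ℝ) ^ L) ^ (-s.re - 1) := by
    intro n hn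
    have hn1 := (Finset.mem_Ico.1 hn).1
    have hn2 : 2 ≤ n := by
      have := Nat.le_self_pow (by omega : L ≠ 0) b
      omega
    refine (hC n hn2).trans ?_
    gcongr ?_ * ?_
    exact Real.rpow_le_rpow_of_nonpos hbL (by exact_mod_cast hn1) (by linarith)
  refine (norm_sum_le_of_le _ h1).trans ?_
  rw [Finset.sum_const, Nat.card_Ico, nsmul_eq_mul]
  have h2 : ((b ^ (L + 1) - b ^ L : ℕ) : ℝ) ≤ (b : ℝ) ^ (L + 1) := by
    exact_mod_cast Nat.sub_le _ _
  calc _ ≤ (b : ℝ) ^ (L + 1) * (C * ((b : ℝ) ^ L) ^ (-s.re - 1)) := by gcongr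
    _ = _ := by
      rw [Real.rpow_sub_one hbL.ne', pow_succ, ← Real.rpow_natCast, ← Real.rpow_natCast,
        ← Real.rpow_mul hb0.le, ← Real.rpow_mul hb0.le, mul_comm (L : ℝ)]
      have : (b : ℝ) ^ (L : ℝ) ≠ 0 := by positivity
      field_simp

lemma AA_limit (b : ℕ) (hb : 1 < b) (s : ℂ) (hs : 0 < s.re) (hs1 : s ≠ 1) :
    Filter.Tendsto (fun L => (1 - s) * AA b s L) Filter.atTop
      (nhds ((1 - s) * (((b : ℂ) ^ s - (b : ℂ)) / (b : ℂ) ^ s * riemannZeta s))) := by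
  have hb0 : (b : ℂ) ≠ 0 := by exact_mod_cast (by omega : b ≠ 0)
  have hbs : (b : ℂ) ^ s ≠ 0 := by simp [Complex.cpow_eq_zero_iff, hb0]
  have hz := zeta_limit s hs hs1
  have hpow : Filter.Tendsto (fun L : ℕ => b ^ L - 1) Filter.atTop Filter.atTop :=
    (Filter.tendsto_sub_atTop_nat 1).comp (tendsto_pow_atTop_atTop_of_one_lt hb)
  have hz1 : Filter.Tendsto (fun L : ℕ => (1 - s) * PP s (b ^ L) - ((b ^ L : ℕ) : ℂ) ^ (1 - s))
      Filter.atTop (nhds ((1 - s) * riemannZeta s)) := by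
    refine (hz.comp hpow).congr fun L => ?_
    have : 1 ≤ b ^ L := Nat.one_le_pow L b (by omega)
    simp only [Function.comp, PP]
    rw [Nat.sub_add_cancel this, Nat.cast_sub this]
    push_cast
    rw [sub_add_cancel]
  have hz2 := (Filter.tendsto_add_atTop_iff_nat 1).2 hz1
  have herr := (err_limit b hb s hs).const_mul (1 - s)
  have hall := ((hz1.const_mul (((b : ℂ) ^ s - (b : ℂ)) / (b : ℂ) ^ s)).add (hz2.sub hz1)).add herr
  convert hall using 2 with L
  · have e : ((b ^ (L + 1) : ℕ) : ℂ) ^ (1 - s) = ((b ^ L : ℕ) : ℂ) ^ (1 - s) * (b / (b : ℂ) ^ s) := by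
      have := Complex.mul_cpow_ofReal_nonneg (a := ((b ^ L : ℕ) : ℝ)) (b := (b : ℝ)) (by positivity)
        (by positivity) (1 - s)
      rw [pow_succ, Nat.cast_mul]
      simp only [Complex.ofReal_natCast] at this
      rw [this, Complex.cpow_sub _ _ hb0, Complex.cpow_one]
    rw [e]
    unfold AA
    field_simp
    ring
  · ring

lemma AA_eq (b : ℕ) (hb : 1 < b) (s : ℂ) (hs : 0 < s.re) (hs1 : s ≠ 1) (L : ℕ) (hL : 1 ≤ L) :
    AA b s L = ((b : ℂ) ^ s - (b : ℂ)) / (b : ℂ) ^ s * riemannZeta s := by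
  have h := AA_limit b hb s hs hs1
  have h2 : Filter.Tendsto (fun L => (1 - s) * AA b s L) Filter.atTop
      (nhds ((1 - s) * AA b s L)) := by
    refine tendsto_const_nhds.congr' ?_
    filter_upwards [Filter.eventually_ge_atTop L] with K hK
    obtain ⟨k, rfl⟩ := Nat.exists_eq_add_of_le hK
    rw [AA_const b hb s hs L hL k]
  exact mul_left_cancel₀ (sub_ne_zero.2 hs1.symm) (tendsto_nhds_unique h2 h)

/-- Theorem 2 (main formula, general b > 1): for Re s > 0, s ≠ 1 and ℓ ≥ 2, the series
∑ₘ (−1)^m (s c*_{m,b}(s)/(s+m)) ∑_{b^{ℓ−1} ≤ n < b^ℓ} n^{−s−m} converges absolutely and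
((b^s−b)/b^s) ζ(s) = ((b^s−b)/b^s) ∑_{0<n<b^{ℓ−1}} n^{−s} + that series. -/
theorem main_formula_general (b : ℕ) (hb : 1 < b) (s : ℂ) (hs : 0 < s.re) (hs1 : s ≠ 1)
    (ℓ : ℕ) (hℓ : 2 ≤ ℓ) :
    Summable (fun m : ℕ => ‖(-1 : ℂ) ^ m * (s * cstarC b s m / (s + (m : ℂ))) *
        ∑ n ∈ Finset.Ico (α := ℕ) (b ^ (ℓ - 1)) (b ^ ℓ), (n : ℂ) ^ (-(s + (m : ℂ)))‖) ∧
    ((b : ℂ) ^ s - (b : ℂ)) / (b : ℂ) ^ s * riemannZeta s =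
      ((b : ℂ) ^ s - (b : ℂ)) / (b : ℂ) ^ s *
          ∑ n ∈ Finset.Ico (α := ℕ) 1 (b ^ (ℓ - 1)), (n : ℂ) ^ (-s) +
      ∑' m : ℕ, (-1 : ℂ) ^ m * (s * cstarC b s m / (s + (m : ℂ))) *
        ∑ n ∈ Finset.Ico (α := ℕ) (b ^ (ℓ - 1)) (b ^ ℓ), (n : ℂ) ^ (-(s + (m : ℂ))) := by
  have hterm : ∀ m : ℕ, (-1 : ℂ) ^ m * (s * cstarC b s m / (s + (m : ℂ))) *
        ∑ n ∈ Finset.Ico (α := ℕ) (b ^ (ℓ - 1)) (b ^ ℓ), (n : ℂ) ^ (-(s + (m : ℂ)))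
      = ∑ n ∈ Finset.Ico (α := ℕ) (b ^ (ℓ - 1)) (b ^ ℓ), hT b s n m := by
    intro m
    rw [Finset.mul_sum]
    rfl
  simp_rw [hterm]
  have hge : ∀ n ∈ Finset.Ico (α := ℕ) (b ^ (ℓ - 1)) (b ^ ℓ), 2 ≤ n := by
    intro n hn
    have h1 := (Finset.mem_Ico.1 hn).1
    have := Nat.le_self_pow (by omega : ℓ - 1 ≠ 0) b
    omega
  constructor
  · refine Summable.of_nonneg_of_le (fun _ => norm_nonneg _) (fun m => norm_sum_le _ _) ?_
    exact summable_sum fun n hn => hT_summable b hb s hs n (hge n hn)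
  · rw [Summable.tsum_finsetSum (fun n hn => (hT_summable b hb s hs n (hge n hn)).of_norm)]
    rw [← AA_eq b hb s hs hs1 (ℓ - 1) (by omega)]
    unfold AA SS PP HH
    rw [Nat.sub_add_cancel (by omega : 1 ≤ ℓ)]
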